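/- arXiv:1506.05711 — 2 statements merged into one kernel-verified Lean document; each statement's English description precedes it below -/
import Mathlib

section
/- Two homomorphisms ∂, ∂' : ℚ → ℚ/ℤ have isomorphic kernels if and only if ∂' = ψ ∘ ∂ ∘ φ for some automorphism φ of ℚ and some automorphism ψ of ℚ/ℤ. Consequently, isomorphism classes of torsion-free abelian groups of rank one are in bijection with the double coset set ℚ^× \ Hom(ℚ, ℚ/ℤ) / Aut(ℚ/ℤ). -/
/-- `ℚ/ℤ` as the quotient of the additive group of rationals by the subgroup ℤ. -/
abbrev QmodZ : Type := ℚ ⧸ AddSubgroup.zmultiples (1 : ℚ)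

/-- The double coset relation on `Hom(ℚ, ℚ/ℤ)`: pre-composition with an
automorphism of `ℚ` and post-composition with an automorphism of `ℚ/ℤ`. -/
def doubleCosetRel (d d' : ℚ →+ QmodZ) : Prop :=
  ∃ (φ : ℚ ≃+ ℚ) (ψ : QmodZ ≃+ QmodZ), ∀ x : ℚ, d' x = ψ (d (φ x))

/-- Any two rationals are integer multiples of a common integer combination of them. -/
lemma Rat.exists_common_generator (x y : ℚ) :
    ∃ (z : ℚ) (a b s t : ℤ), x = a * z ∧ y = b * z ∧ z = s * x + t * y := by
  have hx : (x.den : ℚ) ≠ 0 := by exact_mod_cast x.den_ne_zero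
  have hy : (y.den : ℚ) ≠ 0 := by exact_mod_cast y.den_ne_zero
  set i : ℤ := x.num * y.den with hi
  set j : ℤ := y.num * x.den with hj
  have hxi : x * (x.den * y.den) = i := by
    rw [hi, ← mul_assoc, Rat.mul_den_eq_num]; push_cast; rfl
  have hyj : y * (x.den * y.den) = j := by
    rw [hj, mul_comm (x.den : ℚ), ← mul_assoc, Rat.mul_den_eq_num]; push_cast; rfl
  have hm : ((x.den : ℚ) * y.den) ≠ 0 := mul_ne_zero hx hy
  obtain ⟨a, ha⟩ := Int.gcd_dvd_left i j
  obtain ⟨b, hb⟩ := Int.gcd_dvd_right i j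
  have hg := Int.gcd_eq_gcd_ab i j
  have ha' : (i : ℚ) = ((Int.gcd i j : ℤ) : ℚ) * a := by exact_mod_cast ha
  have hb' : (j : ℚ) = ((Int.gcd i j : ℤ) : ℚ) * b := by exact_mod_cast hb
  have hg' : ((Int.gcd i j : ℤ) : ℚ) = i * Int.gcdA i j + j * Int.gcdB i j := by
    exact_mod_cast hg
  refine ⟨((Int.gcd i j : ℤ) : ℚ) / (x.den * y.den), a, b, Int.gcdA i j, Int.gcdB i j, ?_, ?_, ?_⟩
  · rw [← mul_div_assoc, eq_div_iff hm, hxi, ha']; ring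
  · rw [← mul_div_assoc, eq_div_iff hm, hyj, hb']; ring
  · rw [div_eq_iff hm, hg', ← hxi, ← hyj]; ring

/-- In a quotient of `ℚ`, the elements killed by the order of `y` are multiples of `y`. -/
lemma mem_zmultiples_of_addOrderOf_nsmul_eq_zero {A : AddSubgroup ℚ} (x y : ℚ ⧸ A)
    (hy : 0 < addOrderOf y) (hx : addOrderOf y • x = 0) : x ∈ AddSubgroup.zmultiples y := by
  obtain ⟨z, hxz, hyz, hz⟩ : ∃ z : ℚ ⧸ A, x ∈ AddSubgroup.zmultiples z ∧
      y ∈ AddSubgroup.zmultiples z ∧ addOrderOf y • z = 0 := by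
    have hyn := addOrderOf_nsmul_eq_zero y
    generalize addOrderOf y = n at *
    induction x using QuotientAddGroup.induction_on with | H x => ?_
    induction y using QuotientAddGroup.induction_on with | H y => ?_
    obtain ⟨z, a, b, s, t, h1, h2, h3⟩ := Rat.exists_common_generator x y
    refine ⟨(z : ℚ ⧸ A), ⟨a, ?_⟩, ⟨b, ?_⟩, ?_⟩
    · simp [h1, ← zsmul_eq_mul]
    · simp [h2, ← zsmul_eq_mul]
    · have : (z : ℚ ⧸ A) = s • (x : ℚ ⧸ A) + t • (y : ℚ ⧸ A) := by
        rw [h3, ← zsmul_eq_mul, ← zsmul_eq_mul]; rfl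
      rw [this, nsmul_add, smul_comm n s, smul_comm n t, hx, hyn]; simp
  have hle : AddSubgroup.zmultiples y ≤ AddSubgroup.zmultiples z := by simpa using hyz
  have hdvd : addOrderOf z ∣ addOrderOf y := addOrderOf_dvd_of_nsmul_eq_zero hz
  have hz0 : 0 < addOrderOf z := Nat.pos_of_dvd_of_pos hdvd hy
  have : Finite (AddSubgroup.zmultiples z) := by
    apply Nat.finite_of_card_ne_zero
    rw [Nat.card_zmultiples]; exact hz0.ne'
  have heq := AddSubgroup.eq_of_le_of_card_ge hle (by
    rw [Nat.card_zmultiples, Nat.card_zmultiples]; exact Nat.le_of_dvd hy hdvd)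
  rw [heq]; exact hxz

/-- The quotient of `ℚ` by a nonzero subgroup is torsion. -/
lemma exists_pos_nsmul_eq_zero {A : AddSubgroup ℚ} (hA : A ≠ ⊥) (x : ℚ ⧸ A) :
    ∃ n : ℕ, 0 < n ∧ n • x = 0 := by
  induction x using QuotientAddGroup.induction_on with | H x => ?_
  obtain ⟨a, ha, ha0⟩ := A.bot_or_exists_ne_zero.resolve_left hA
  have hnum : a.num ≠ 0 := Rat.num_ne_zero.2 ha0
  refine ⟨a.num.natAbs * x.den, Nat.mul_pos (Int.natAbs_pos.2 hnum) x.pos, ?_⟩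
  have key : (a.num * x.den : ℤ) • x = (x.num * a.den : ℤ) • a := by
    have h1 := Rat.mul_den_eq_num x
    have h2 := Rat.mul_den_eq_num a
    simp only [zsmul_eq_mul]
    push_cast
    rw [← h1, ← h2]; ring
  have hz : (a.num * x.den : ℤ) • (x : ℚ ⧸ A) = 0 := by
    rw [← QuotientAddGroup.mk_zsmul, key, QuotientAddGroup.eq_zero_iff]
    exact A.zsmul_mem ha _
  simpa [Int.natAbs_mul] using natAbs_nsmul_eq_zero.2 hz

/-- A character can be altered, away from the `n!`-torsion, so as to be injective on the
`(n + 1)`-torsion when `n + 1` is prime. -/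
lemma exists_character_correction {A : AddSubgroup ℚ} (h : ℚ ⧸ A →+ QmodZ) (n : ℕ) :
    ∃ h' : ℚ ⧸ A →+ QmodZ, (∀ x, n.factorial • x = 0 → h' x = h x) ∧
      ((n + 1).Prime → ∀ x, x ≠ 0 → (n + 1) • x = 0 → h' x ≠ 0) := by
  by_cases hp : (n + 1).Prime
  swap
  · exact ⟨h, fun _ _ => rfl, fun h0 => absurd h0 hp⟩
  have hord : ∀ x : ℚ ⧸ A, x ≠ 0 → (n + 1) • x = 0 → addOrderOf x = n + 1 := fun x hx hnx =>
    haveI := Fact.mk hp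
    addOrderOf_eq_prime hnx hx
  have suff : ∀ (g : ℚ ⧸ A →+ QmodZ) (x : ℚ ⧸ A), (n + 1) • x = 0 → g x ≠ 0 →
      ∀ y, y ≠ 0 → (n + 1) • y = 0 → g y ≠ 0 := by
    intro g x hx hgx y hy hny hgy
    have ho := hord y hy hny
    obtain ⟨k, rfl⟩ := mem_zmultiples_of_addOrderOf_nsmul_eq_zero x y (by omega) (by rwa [ho])
    exact hgx (by simp [hgy])
  by_cases hall : ∀ x, x ≠ 0 → (n + 1) • x = 0 → h x ≠ 0
  · exact ⟨h, fun _ _ => rfl, fun _ => hall⟩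
  push Not at hall
  obtain ⟨x, hx, hnx, hhx⟩ := hall
  have hfx : n.factorial • x ≠ 0 := by
    intro h0
    have hd := addOrderOf_dvd_of_nsmul_eq_zero h0
    rw [hord x hx hnx, hp.dvd_factorial] at hd
    omega
  obtain ⟨c, hc⟩ := CharacterModule.exists_character_apply_ne_zero_of_ne_zero hfx
  let c' : ℚ ⧸ A →+ QmodZ := c
  have hc' : c' (n.factorial • x) ≠ 0 := hc
  refine ⟨h + n.factorial • c', fun y hy => ?_, fun _ => suff _ x hnx ?_⟩
  · simp [← map_nsmul, hy]
  · simpa [hhx, map_nsmul] using hc'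

/-- The quotient of `ℚ` by a nonzero subgroup embeds in `ℚ/ℤ`. -/
lemma exists_injective_hom_QmodZ {A : AddSubgroup ℚ} (hA : A ≠ ⊥) :
    ∃ h : ℚ ⧸ A →+ QmodZ, Function.Injective h := by
  choose step hstep hprime using exists_character_correction (A := A)
  let H : ℕ → (ℚ ⧸ A →+ QmodZ) := fun n => Nat.rec 0 (fun n h => step h n) n
  have hH : ∀ n, H (n + 1) = step (H n) n := fun _ => rfl
  have stable : ∀ (x : ℚ ⧸ A) (N : ℕ), 0 < N → N • x = 0 → ∀ n, N ≤ n → H n x = H N x := by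
    intro x N hN hx n hn
    induction n, hn using Nat.le_induction with
    | base => rfl
    | succ n hn ih =>
      rw [hH, hstep, ih]
      obtain ⟨k, hk⟩ := Nat.dvd_factorial hN hn
      rw [hk, mul_comm, mul_nsmul', hx, nsmul_zero]
  choose ord hpos hord using exists_pos_nsmul_eq_zero hA
  let h : ℚ ⧸ A →+ QmodZ := AddMonoidHom.mk' (fun x => H (ord x) x) (by
    intro x y
    let n := ord x + ord y + ord (x + y)
    rw [← stable x _ (hpos x) (hord x) n (by omega), ← stable y _ (hpos y) (hord y) n (by omega),
      ← stable (x + y) _ (hpos _) (hord _) n (by omega), map_add])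
  have h_eq : ∀ (x : ℚ ⧸ A) (N : ℕ), 0 < N → N • x = 0 → h x = H N x := fun x N hN hx => by
    change H (ord x) x = _
    rw [← stable x _ (hpos x) (hord x) (ord x + N) (by omega),
      ← stable x N hN hx (ord x + N) (by omega)]
  refine ⟨h, (injective_iff_map_eq_zero h).2 fun x hx => ?_⟩
  by_contra hx0
  have hone : addOrderOf x ≠ 1 := fun h1 => hx0 (AddMonoid.addOrderOf_eq_one_iff.1 h1)
  have hop : 0 < addOrderOf x :=
    Nat.pos_of_dvd_of_pos (addOrderOf_dvd_of_nsmul_eq_zero (hord x)) (hpos x)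
  obtain ⟨p, hp, k, hk⟩ := Nat.exists_prime_and_dvd hone
  have hkx : k • x ≠ 0 := by
    intro h0
    have hd := Nat.le_of_dvd (Nat.pos_of_ne_zero (by rintro rfl; omega))
      (addOrderOf_dvd_of_nsmul_eq_zero h0)
    have := hp.two_le
    nlinarith
  have hpk : p • k • x = 0 := by
    rw [← mul_nsmul', ← hk, addOrderOf_nsmul_eq_zero]
  have h0 : h (k • x) = 0 := by rw [map_nsmul, hx, nsmul_zero]
  rw [h_eq _ p hp.pos hpk] at h0
  obtain ⟨n, rfl⟩ : ∃ n, p = n + 1 := ⟨p - 1, by have := hp.pos; omega⟩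
  exact hprime (H n) n hp _ hkx hpk h0

lemma zmultiples_one_rat_ne_bot : AddSubgroup.zmultiples (1 : ℚ) ≠ ⊥ := by
  simp

lemma ker_hom_QmodZ_ne_bot (d : ℚ →+ QmodZ) : d.ker ≠ ⊥ := by
  obtain ⟨n, hn, h⟩ := exists_pos_nsmul_eq_zero zmultiples_one_rat_ne_bot (d 1)
  intro hb
  have : n • (1 : ℚ) ∈ d.ker := by rw [AddMonoidHom.mem_ker, map_nsmul, h]
  rw [hb, AddSubgroup.mem_bot] at this
  simp at this
  omega

/-- An additive map out of a subgroup of `ℚ` is multiplication by a rational. -/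
lemma exists_rat_mul_of_hom {A : AddSubgroup ℚ} (f : A →+ ℚ) : ∃ q : ℚ, ∀ x : A, f x = q * x := by
  by_cases hA : A = ⊥
  · subst hA
    exact ⟨0, fun x => by rw [Subsingleton.elim x 0]; simp⟩
  obtain ⟨a, ha⟩ := AddSubgroup.ne_bot_iff_exists_ne_zero.1 hA
  have ha0 : (a : ℚ) ≠ 0 := fun h0 => ha (Subtype.ext h0)
  refine ⟨f a / a, fun x => ?_⟩
  obtain ⟨z, i, j, -, -, hx, hy, -⟩ := Rat.exists_common_generator x a
  have hj : (j : ℚ) * z ≠ 0 := hy ▸ ha0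
  have hj0 : (j : ℚ) ≠ 0 := left_ne_zero_of_mul hj
  have hz0 : z ≠ 0 := right_ne_zero_of_mul hj
  have key : j • x = i • a := Subtype.ext (by
    simp only [AddSubgroup.coe_zsmul, zsmul_eq_mul, hx, hy]; ring)
  have := congrArg f key
  simp only [map_zsmul, zsmul_eq_mul] at this
  rw [hx, hy]
  field_simp
  linarith

/-- An isomorphism between nonzero subgroups of `ℚ` extends to an automorphism of `ℚ`. -/
lemma exists_addEquiv_mem_iff {A B : AddSubgroup ℚ} (hA : A ≠ ⊥) (e : A ≃+ B) :
    ∃ φ : ℚ ≃+ ℚ, ∀ x, φ x ∈ A ↔ x ∈ B := by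
  obtain ⟨q, hq⟩ := exists_rat_mul_of_hom (B.subtype.comp e.toAddMonoidHom)
  replace hq : ∀ x : A, (e x : ℚ) = q * x := hq
  have hq0 : q ≠ 0 := by
    rintro rfl
    obtain ⟨a, ha⟩ := AddSubgroup.ne_bot_iff_exists_ne_zero.1 hA
    exact ha (e.injective (Subtype.ext (by simp [hq])))
  refine ⟨DistribMulAction.toAddEquiv₀ ℚ q⁻¹ (inv_ne_zero hq0), fun x => ?_⟩
  change q⁻¹ * x ∈ A ↔ x ∈ B
  constructor
  · intro hx
    have := (e ⟨_, hx⟩).2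
    rwa [hq, mul_inv_cancel_left₀ hq0] at this
  · intro hx
    have h1 := hq (e.symm ⟨x, hx⟩)
    rw [e.apply_symm_apply] at h1
    change x = _ at h1
    rw [h1, inv_mul_cancel_left₀ hq0]
    exact (e.symm ⟨x, hx⟩).2

lemma range_le_range_of_ker_eq {d d' : ℚ →+ QmodZ} (h : d.ker = d'.ker) :
    d.range ≤ d'.range := by
  rintro _ ⟨x, rfl⟩
  have hiff : ∀ n : ℕ, n • d x = 0 ↔ n • d' x = 0 := fun n => by
    rw [← map_nsmul, ← map_nsmul, ← AddMonoidHom.mem_ker, ← AddMonoidHom.mem_ker, h]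
  obtain ⟨n, hn, hz⟩ := exists_pos_nsmul_eq_zero zmultiples_one_rat_ne_bot (d' x)
  obtain ⟨k, hk⟩ := mem_zmultiples_of_addOrderOf_nsmul_eq_zero (d x) (d' x)
    (Nat.pos_of_dvd_of_pos (addOrderOf_dvd_of_nsmul_eq_zero hz) hn)
    ((hiff _).2 (addOrderOf_nsmul_eq_zero _))
  exact ⟨k • x, by rw [map_zsmul]; exact hk⟩

/-- An automorphism of a divisible subgroup extends to the whole group. -/
lemma exists_addEquiv_extending {E : Type*} [AddCommGroup E] (D : AddSubgroup E)
    [DivisibleBy D ℤ] (e : D ≃+ D) : ∃ ψ : E ≃+ E, ∀ x : D, ψ x = e x := by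
  obtain ⟨r, hr⟩ := Module.Baer.extension_property_addMonoidHom (Module.Baer.of_divisible D)
    D.subtype D.subtype_injective (AddMonoidHom.id D)
  replace hr : ∀ x : D, r x = x := fun x => DFunLike.congr_fun hr x
  let ext (e : D ≃+ D) : E →+ E :=
    D.subtype.comp (e.toAddMonoidHom.comp r) + (AddMonoidHom.id E - D.subtype.comp r)
  have ext_apply : ∀ (e : D ≃+ D) (x : E), ext e x = e (r x) + (x - r x) := fun _ _ => rfl
  have ext_inv : ∀ (e : D ≃+ D) (x : E), ext e.symm (ext e x) = x := fun e x => by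
    simp only [ext_apply, map_add, map_sub, hr]
    simp
  refine ⟨{ ext e with
    invFun := ext e.symm
    left_inv := ext_inv e
    right_inv := ext_inv e.symm }, fun x => ?_⟩
  change ext e x = e x
  simp [ext_apply, hr]

lemma exists_addEquiv_of_ker_eq {d d' : ℚ →+ QmodZ} (h : d.ker = d'.ker) :
    ∃ ψ : QmodZ ≃+ QmodZ, ∀ x, d' x = ψ (d x) := by
  have hR : d.range = d'.range :=
    le_antisymm (range_le_range_of_ker_eq h) (range_le_range_of_ker_eq h.symm)
  let e : d.range ≃+ d.range := (QuotientAddGroup.quotientKerEquivRange d).symm.trans <|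
    (QuotientAddGroup.quotientAddEquivOfEq h).trans <|
    (QuotientAddGroup.quotientKerEquivRange d').trans (AddEquiv.addSubgroupCongr hR.symm)
  have he : ∀ x : ℚ, (e (d.rangeRestrict x) : QmodZ) = d' x := fun x => by
    have : (QuotientAddGroup.quotientKerEquivRange d).symm (d.rangeRestrict x) =
        (x : ℚ ⧸ d.ker) := by
      rw [AddEquiv.symm_apply_eq]; rfl
    simp only [e, AddEquiv.trans_apply, this]
    rfl
  let _ : DivisibleBy d.range ℤ :=
    Function.Surjective.divisibleBy d.rangeRestrict d.rangeRestrict_surjective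
      fun a n => map_zsmul d.rangeRestrict n a
  obtain ⟨ψ, hψ⟩ := exists_addEquiv_extending d.range e
  exact ⟨ψ, fun x => by rw [← he, ← hψ]; rfl⟩

lemma nonempty_ker_addEquiv_iff (d d' : ℚ →+ QmodZ) :
    Nonempty (d.ker ≃+ d'.ker) ↔ doubleCosetRel d d' := by
  constructor
  · rintro ⟨e⟩
    obtain ⟨φ, hφ⟩ := exists_addEquiv_mem_iff (ker_hom_QmodZ_ne_bot d) e
    obtain ⟨ψ, hψ⟩ := exists_addEquiv_of_ker_eq (d := d.comp φ.toAddMonoidHom) (d' := d')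
      (AddSubgroup.ext hφ)
    exact ⟨φ, ψ, hψ⟩
  · rintro ⟨φ, ψ, h⟩
    have hker : d'.ker.map φ.toAddMonoidHom = d.ker := by
      ext y
      constructor
      · rintro ⟨x, hx, rfl⟩
        have hx' : d' x = 0 := hx
        rw [h, map_eq_zero_iff ψ ψ.injective] at hx'
        exact hx'
      · intro hy
        refine ⟨φ.symm y, ?_, φ.apply_symm_apply y⟩
        have hy' : d y = 0 := hy
        change d' (φ.symm y) = 0
        rw [h, φ.apply_symm_apply, hy', map_zero]
    exact ⟨((φ.addSubgroupMap d'.ker).trans (AddEquiv.addSubgroupCongr hker)).symm⟩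

lemma exists_hom_QmodZ_ker_eq {A : AddSubgroup ℚ} (hA : A ≠ ⊥) :
    ∃ d : ℚ →+ QmodZ, d.ker = A := by
  obtain ⟨h, hh⟩ := exists_injective_hom_QmodZ hA
  refine ⟨h.comp (QuotientAddGroup.mk' A), ?_⟩
  ext x
  simp [AddMonoidHom.mem_ker, map_eq_zero_iff h hh]

/-- Two homomorphisms `∂, ∂' : ℚ → ℚ/ℤ` have isomorphic kernels iff
`∂' = ψ ∘ ∂ ∘ φ` for automorphisms `φ` of `ℚ` and `ψ` of `ℚ/ℤ`.  Consequently
isomorphism classes of torsion-free abelian groups of rank one (nonzero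
subgroups of `ℚ` up to isomorphism) are in bijection with the double coset set
`ℚ^× \ Hom(ℚ, ℚ/ℤ) / Aut(ℚ/ℤ)`. -/
theorem kernels_iso_iff_doubleCoset :
    (∀ d d' : ℚ →+ QmodZ,
      Nonempty (d.ker ≃+ d'.ker) ↔ doubleCosetRel d d') ∧
    Nonempty (Quot doubleCosetRel ≃
      Quot (fun A B : {A : AddSubgroup ℚ // A ≠ ⊥} => Nonempty (A.1 ≃+ B.1))) := by
  refine ⟨nonempty_ker_addEquiv_iff, ⟨Equiv.ofBijective
    (Quot.map (fun d => ⟨d.ker, ker_hom_QmodZ_ne_bot d⟩)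
      fun d d' => (nonempty_ker_addEquiv_iff d d').2) ⟨?_, ?_⟩⟩⟩
  · rintro ⟨d⟩ ⟨d'⟩ h
    have heqv : Equivalence (fun A B : {A : AddSubgroup ℚ // A ≠ ⊥} => Nonempty (A.1 ≃+ B.1)) :=
      ⟨fun A => ⟨AddEquiv.refl A.1⟩, fun ⟨e⟩ => ⟨e.symm⟩, fun ⟨e⟩ ⟨f⟩ => ⟨e.trans f⟩⟩
    exact Quot.sound ((nonempty_ker_addEquiv_iff d d').1
      (heqv.eqvGen_iff.1 (Quot.eqvGen_exact h)))
  · rintro ⟨A, hA⟩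
    obtain ⟨d, rfl⟩ := exists_hom_QmodZ_ker_eq hA
    exact ⟨Quot.mk _ d, rfl⟩
end

section
/- Two torsion-free abelian groups of rank one, realized as subgroups A, B of ℚ containing ℤ, are isomorphic if and only if their height sequences (k_p(A))_p and (k_p(B))_p are similar, i.e., k_p(A) = k_p(B) for all but finitely many primes, they are infinite at exactly the same primes, and the sum of the finite differences |k_p(A) − k_p(B)| is finite. -/
open scoped Classical

/-- The `p`-height of `1` in a subgroup `A ≤ ℚ`:
`k_p(A) = sup { r ≥ 0 : 1 ∈ p^r A } ∈ ℕ ∪ {∞}`. -/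
noncomputable def pHeight (A : AddSubgroup ℚ) (p : ℕ) : ℕ∞ :=
  ⨆ r ∈ {r : ℕ | ((p : ℚ) ^ r)⁻¹ ∈ A}, (r : ℕ∞)

namespace RankOne

variable {A B : AddSubgroup ℚ}

lemma one_mem_of_zmultiples_le (h : AddSubgroup.zmultiples (1 : ℚ) ≤ A) : (1 : ℚ) ∈ A :=
  h (AddSubgroup.mem_zmultiples 1)

lemma intCast_mul_mem {x : ℚ} (hx : x ∈ A) (n : ℤ) : (n : ℚ) * x ∈ A := by
  simpa using A.zsmul_mem hx n

lemma inv_mem_of_dvd {d n : ℕ} (hn : n ≠ 0) (hd : d ∣ n) (h : (n : ℚ)⁻¹ ∈ A) :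
    (d : ℚ)⁻¹ ∈ A := by
  obtain ⟨c, rfl⟩ := hd
  have hc : (c : ℚ) ≠ 0 := by exact_mod_cast right_ne_zero_of_mul hn
  have key := intCast_mul_mem h c
  rwa [show ((c : ℤ) : ℚ) * ((d * c : ℕ) : ℚ)⁻¹ = (d : ℚ)⁻¹ by
    push_cast; field_simp] at key

lemma inv_mul_mem {a b : ℕ} (ha : a ≠ 0) (hb : b ≠ 0) (hab : a.Coprime b)
    (hAa : (a : ℚ)⁻¹ ∈ A) (hAb : (b : ℚ)⁻¹ ∈ A) : ((a * b : ℕ) : ℚ)⁻¹ ∈ A := by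
  obtain ⟨u, v, huv⟩ := Nat.isCoprime_iff_coprime.mpr hab
  have huv' : (u : ℚ) * a + v * b = 1 := by exact_mod_cast huv
  have ha' : (a : ℚ) ≠ 0 := by exact_mod_cast ha
  have hb' : (b : ℚ) ≠ 0 := by exact_mod_cast hb
  have key := A.add_mem (intCast_mul_mem hAb u) (intCast_mul_mem hAa v)
  rwa [show (u : ℚ) * (b : ℚ)⁻¹ + v * (a : ℚ)⁻¹ = ((a * b : ℕ) : ℚ)⁻¹ by
    push_cast; field_simp; linarith] at key

lemma mem_iff_inv_den_mem (h1 : (1 : ℚ) ∈ A) (x : ℚ) : x ∈ A ↔ (x.den : ℚ)⁻¹ ∈ A := by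
  have hx : (x.num : ℚ) * (x.den : ℚ)⁻¹ = x := by
    rw [← div_eq_mul_inv, Rat.num_div_den]
  refine ⟨fun h => ?_, fun h => hx ▸ intCast_mul_mem h x.num⟩
  obtain ⟨u, v, huv⟩ := x.isCoprime_num_den
  have huv' : (u : ℚ) * x.num + v * x.den = 1 := by exact_mod_cast huv
  have key := A.add_mem (intCast_mul_mem h u) (intCast_mul_mem h1 v)
  rwa [show (u : ℚ) * x + v * 1 = (x.den : ℚ)⁻¹ by
    refine eq_inv_of_mul_eq_one_left ?_
    rw [mul_one, add_mul, mul_assoc, Rat.mul_den_eq_num, huv']] at key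

lemma inv_natCast_mem_iff (h1 : (1 : ℚ) ∈ A) {n : ℕ} (hn : n ≠ 0) :
    (n : ℚ)⁻¹ ∈ A ↔ ∀ p : ℕ, p.Prime → ((p : ℚ) ^ n.factorization p)⁻¹ ∈ A := by
  refine ⟨fun h p _ => ?_, fun h => ?_⟩
  · exact_mod_cast inv_mem_of_dvd hn (Nat.ordProj_dvd n p) h
  · induction n using Nat.recOnPosPrimePosCoprime with
    | zero => exact absurd rfl hn
    | one => simpa using h1
    | prime_pow p k hp _ => simpa [hp.factorization_pow] using h p hp
    | coprime a b ha hb hab iha ihb =>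
      have ha0 : a ≠ 0 := by omega
      have hb0 : b ≠ 0 := by omega
      refine inv_mul_mem ha0 hb0 hab (iha ha0 fun p hp => ?_) (ihb hb0 fun p hp => ?_)
      all_goals
        have key := h p hp
        rw [Nat.factorization_mul ha0 hb0, Finsupp.add_apply] at key
        have hp0 := hp.ne_zero
        refine mod_cast inv_mem_of_dvd (n := p ^ (a.factorization p + b.factorization p))
          (pow_ne_zero _ hp0) (pow_dvd_pow p ?_) (mod_cast key)
        omega

lemma natCast_le_pHeight_iff (h1 : (1 : ℚ) ∈ A) {p : ℕ} (hp : p.Prime) (r : ℕ) :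
    (r : ℕ∞) ≤ pHeight A p ↔ ((p : ℚ) ^ r)⁻¹ ∈ A := by
  refine ⟨fun h => ?_, fun h => le_iSup₂_of_le (f := fun (r : ℕ) _ => (r : ℕ∞)) r h le_rfl⟩
  cases r with
  | zero => simpa using h1
  | succ r =>
    have hlt : (r : ℕ∞) < pHeight A p :=
      lt_of_lt_of_le (by exact_mod_cast Nat.lt_succ_self r) h
    simp only [pHeight, lt_iSup_iff] at hlt
    obtain ⟨s, hs, hrs⟩ := hlt
    have hrs' : r + 1 ≤ s := by exact_mod_cast hrs
    exact_mod_cast inv_mem_of_dvd (n := p ^ s) (pow_ne_zero _ hp.ne_zero)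
      (pow_dvd_pow p hrs') (by exact_mod_cast hs)

lemma factorization_den_eq (x : ℚ) {p : ℕ} (hp : p.Prime) :
    x.den.factorization p = (-padicValRat p x).toNat := by
  rw [Nat.factorization_def _ hp, padicValRat_def, padicValInt]
  by_cases hd : p ∣ x.den
  · have hn : ¬ p ∣ x.num.natAbs := fun hn =>
      hp.one_lt.ne' (Nat.dvd_one.mp (x.reduced ▸ Nat.dvd_gcd hn hd))
    rw [padicValNat.eq_zero_of_not_dvd hn]
    omega
  · rw [padicValNat.eq_zero_of_not_dvd hd]
    omega

/-- A rational lies in `A` iff the exponents of its denominator are bounded by the heights. -/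
lemma mem_iff_le_pHeight (h1 : (1 : ℚ) ∈ A) (x : ℚ) :
    x ∈ A ↔ ∀ p : ℕ, p.Prime → ((-padicValRat p x).toNat : ℕ∞) ≤ pHeight A p := by
  rw [mem_iff_inv_den_mem h1, inv_natCast_mem_iff h1 x.den_ne_zero]
  refine forall₂_congr fun p hp => ?_
  rw [natCast_le_pHeight_iff h1 hp, factorization_den_eq x hp]

lemma exists_padicValRat_eq (S : Finset ℕ) (hS : ∀ p ∈ S, p.Prime) (f : ℕ → ℤ) :
    ∃ q : ℚ, q ≠ 0 ∧ ∀ p : ℕ, p.Prime → padicValRat p q = if p ∈ S then f p else 0 := by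
  induction S using Finset.induction_on with
  | empty => exact ⟨1, one_ne_zero, by simp⟩
  | insert l S hl ih =>
    obtain ⟨q, hq, hval⟩ := ih fun p hp => hS p (Finset.mem_insert_of_mem hp)
    have hlp : l.Prime := hS l (Finset.mem_insert_self l S)
    have hl0 : (l : ℚ) ^ f l ≠ 0 := zpow_ne_zero _ (by exact_mod_cast hlp.ne_zero)
    refine ⟨(l : ℚ) ^ f l * q, mul_ne_zero hl0 hq, fun p hp => ?_⟩
    have : Fact p.Prime := ⟨hp⟩
    have : Fact l.Prime := ⟨hlp⟩
    rw [padicValRat.mul hl0 hq, hval p hp, padicValRat.zpow, padicValRat.of_nat]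
    by_cases hpl : p = l
    · subst hpl
      simp [hl]
    · simp [padicValNat_primes hpl, hpl]

lemma nonempty_addEquiv_of_mul_mem_iff {q : ℚ} (hq : q ≠ 0)
    (h : ∀ x, x ∈ A ↔ q * x ∈ B) : Nonempty (A ≃+ B) :=
  ⟨{  toFun := fun x => ⟨q * x, (h x).mp x.2⟩
      invFun := fun y => ⟨q⁻¹ * y, (h _).mpr (by simp [hq])⟩
      left_inv := fun x => by simp [hq]
      right_inv := fun y => by simp [hq]
      map_add' := fun x y => by ext; simp [mul_add] }⟩

lemma apply_eq_apply_one_mul (h1 : (1 : ℚ) ∈ A) (f : A →+ B) (x : A) :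
    (f x : ℚ) = f ⟨1, h1⟩ * x := by
  have hx : (x : ℚ).den • x = (x : ℚ).num • (⟨1, h1⟩ : A) := by
    ext
    simp [Rat.den_mul_eq_num]
  have hfx := congrArg (fun y : B => (y : ℚ)) (congrArg f hx)
  simp only [map_nsmul, map_zsmul, AddSubgroup.coe_nsmul, AddSubgroup.coe_zsmul,
    nsmul_eq_mul, zsmul_eq_mul] at hfx
  have hd : ((x : ℚ).den : ℚ) ≠ 0 := by exact_mod_cast (x : ℚ).den_ne_zero
  rw [← mul_right_inj' hd, hfx, ← Rat.den_mul_eq_num]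
  ring

/-- An injective homomorphism `A → B` sending `1` to `q` bounds the heights of `A` by those
of `B`, shifted by the valuation of `q`. -/
lemma toNat_sub_le_pHeight (hA : (1 : ℚ) ∈ A) (hB : (1 : ℚ) ∈ B) {q : ℚ} (hq : q ≠ 0)
    (h : ∀ x ∈ A, q * x ∈ B) {p : ℕ} (hp : p.Prime) {r : ℕ} (hr : (r : ℕ∞) ≤ pHeight A p) :
    ((r - padicValRat p q).toNat : ℕ∞) ≤ pHeight B p := by
  have : Fact p.Prime := ⟨hp⟩
  have hp0 : (p : ℚ) ^ r ≠ 0 := pow_ne_zero _ (by exact_mod_cast hp.ne_zero)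
  have key := (mem_iff_le_pHeight hB _).mp (h _ ((natCast_le_pHeight_iff hA hp r).mp hr)) p hp
  rwa [padicValRat.mul hq (inv_ne_zero hp0), padicValRat.inv, padicValRat.pow,
    padicValRat.self hp.one_lt, mul_one, neg_add, neg_neg, neg_add_eq_sub] at key

lemma pHeight_eq_top_of_mul_mem (hA : (1 : ℚ) ∈ A) (hB : (1 : ℚ) ∈ B) {q : ℚ} (hq : q ≠ 0)
    (h : ∀ x ∈ A, q * x ∈ B) {p : ℕ} (hp : p.Prime) (htop : pHeight A p = ⊤) :
    pHeight B p = ⊤ := by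
  refine ENat.eq_top_iff_forall_ge.mpr fun n => ?_
  have key := toNat_sub_le_pHeight hA hB hq h hp
    (r := n + (padicValRat p q).toNat) (by simp [htop])
  refine le_trans ?_ key
  norm_cast
  omega

lemma pHeight_le_of_mul_mem (hA : (1 : ℚ) ∈ A) (hB : (1 : ℚ) ∈ B) {q : ℚ} (hq : q ≠ 0)
    (h : ∀ x ∈ A, q * x ∈ B) {p : ℕ} (hp : p.Prime) (hval : padicValRat p q = 0) :
    pHeight A p ≤ pHeight B p := by
  refine ENat.forall_natCast_le_iff_le.mp fun r hr => ?_
  simpa [hval] using toNat_sub_le_pHeight hA hB hq h hp hr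

lemma finite_setOf_padicValRat_ne_zero {q : ℚ} (hq : q ≠ 0) :
    {p : ℕ | padicValRat p q ≠ 0}.Finite := by
  refine (q.num.natAbs.divisors ∪ q.den.divisors).finite_toSet.subset fun p hp => ?_
  by_contra hdvd
  simp only [Finset.coe_union, Set.mem_union, Finset.mem_coe, Nat.mem_divisors, not_or,
    not_and_or, not_not, Int.natAbs_eq_zero, Rat.num_eq_zero, hq, q.den_ne_zero, or_false] at hdvd
  apply hp
  rw [padicValRat_def, padicValInt, padicValNat.eq_zero_of_not_dvd hdvd.1,
    padicValNat.eq_zero_of_not_dvd hdvd.2]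
  simp

/-- Isomorphic rank-one groups are related by multiplication by a nonzero rational. -/
lemma exists_mul_mem_iff_of_addEquiv (hA : (1 : ℚ) ∈ A) (e : A ≃+ B) :
    ∃ q : ℚ, q ≠ 0 ∧ ∀ x, x ∈ A ↔ q * x ∈ B := by
  have he : ∀ x : A, (e x : ℚ) = e ⟨1, hA⟩ * x := apply_eq_apply_one_mul hA e.toAddMonoidHom
  have hq : (e ⟨1, hA⟩ : ℚ) ≠ 0 := fun h0 => by
    have h1 := e.map_eq_zero_iff.mp (Subtype.ext h0)
    exact one_ne_zero (congrArg Subtype.val h1)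
  refine ⟨e ⟨1, hA⟩, hq, fun x => ⟨fun hx => ?_, fun hx => ?_⟩⟩
  · exact he ⟨x, hx⟩ ▸ (e ⟨x, hx⟩).2
  · obtain ⟨y, hy⟩ := e.surjective ⟨_, hx⟩
    have hxy := (he y).symm.trans (congrArg Subtype.val hy)
    exact mul_left_cancel₀ hq hxy ▸ y.2

/-- Similar height sequences are matched by multiplication by a nonzero rational. -/
lemma exists_mul_mem_iff_of_similar (hA : (1 : ℚ) ∈ A) (hB : (1 : ℚ) ∈ B)
    (htop : ∀ p : ℕ, p.Prime → (pHeight A p = ⊤ ↔ pHeight B p = ⊤))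
    (hfin : {p : ℕ | p.Prime ∧ pHeight A p ≠ pHeight B p}.Finite) :
    ∃ q : ℚ, q ≠ 0 ∧ ∀ x, x ∈ A ↔ q * x ∈ B := by
  obtain ⟨q, hq, hval⟩ := exists_padicValRat_eq hfin.toFinset (by simp +contextual)
    fun p => (pHeight A p).toNat - (pHeight B p).toNat
  refine ⟨q, hq, fun x => ?_⟩
  obtain rfl | hx := eq_or_ne x 0
  · simp [A.zero_mem, B.zero_mem]
  rw [mem_iff_le_pHeight hA, mem_iff_le_pHeight hB]
  refine forall₂_congr fun p hp => ?_
  have : Fact p.Prime := ⟨hp⟩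
  rw [padicValRat.mul hq hx, hval p hp]
  by_cases heq : pHeight A p = pHeight B p
  · simp [heq]
  have hAtop : pHeight A p ≠ ⊤ := fun h => heq (h.trans ((htop p hp).mp h).symm)
  have hBtop : pHeight B p ≠ ⊤ := fun h => hAtop ((htop p hp).mpr h)
  rw [if_pos (by simpa using ⟨hp, heq⟩)]
  lift pHeight A p to ℕ using hAtop with a
  lift pHeight B p to ℕ using hBtop with b
  simp only [ENat.toNat_natCast, Nat.cast_le]
  omega

end RankOne

open RankOne in
/-- Two rank-one torsion-free abelian groups, realized as subgroups `A, B` of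
`ℚ` containing `ℤ`, are isomorphic iff their height sequences are similar:
they are infinite at exactly the same primes and differ at only finitely many
primes (hence the total finite difference is finite). -/
theorem rank_one_iso_iff_similar_heights (A B : AddSubgroup ℚ)
    (hA : AddSubgroup.zmultiples (1 : ℚ) ≤ A)
    (hB : AddSubgroup.zmultiples (1 : ℚ) ≤ B) :
    Nonempty (A ≃+ B) ↔
      ((∀ p : ℕ, p.Prime → (pHeight A p = ⊤ ↔ pHeight B p = ⊤)) ∧
        {p : ℕ | p.Prime ∧ pHeight A p ≠ pHeight B p}.Finite) := by
  have h1A := one_mem_of_zmultiples_le hA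
  have h1B := one_mem_of_zmultiples_le hB
  refine ⟨fun ⟨e⟩ => ?_, fun ⟨htop, hfin⟩ => ?_⟩
  · obtain ⟨q, hq, h⟩ := exists_mul_mem_iff_of_addEquiv h1A e
    have hAB : ∀ x ∈ A, q * x ∈ B := fun x => (h x).mp
    have hBA : ∀ x ∈ B, q⁻¹ * x ∈ A := fun x hx => (h _).mpr (by simpa [hq] using hx)
    have hq' := inv_ne_zero hq
    refine ⟨fun p hp => ⟨pHeight_eq_top_of_mul_mem h1A h1B hq hAB hp,
      pHeight_eq_top_of_mul_mem h1B h1A hq' hBA hp⟩,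
      (finite_setOf_padicValRat_ne_zero hq).subset fun p hp hval => hp.2 ?_⟩
    have : Fact p.Prime := ⟨hp.1⟩
    exact le_antisymm (pHeight_le_of_mul_mem h1A h1B hq hAB hp.1 hval)
      (pHeight_le_of_mul_mem h1B h1A hq' hBA hp.1 (by rw [padicValRat.inv, hval, neg_zero]))
  · obtain ⟨q, hq, h⟩ := exists_mul_mem_iff_of_similar h1A h1B htop hfin
    exact nonempty_addEquiv_of_mul_mem_iff hq h
end
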